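/- Fault-tolerance correctness: let T = T_o ⊔ T_d be a partition of the selected clients into online and dropped clients. Each online client k ∈ T_o submits w'_k = w_k + r_k (mod M) with r_k = Σ_{n ∈ T, n ≠ k} ε(k,n) h(k,n), and additionally submits the recovery vector q_k = Σ_{n ∈ T_d} ε(k,n) h(k,n) (mod M). Then (Σ_{k ∈ T_o} w'_k) − (Σ_{k ∈ T_o} q_k) ≡ Σ_{k ∈ T_o} w_k (mod M). -/

import Mathlib

/-- The off-diagonal sum of a function that is antisymmetric off the diagonal vanishes. -/
theorem Finset.sum_sum_erase_eq_zero_of_antisymm {ι A : Type*} [DecidableEq ι]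
    [AddCommGroup A] (s : Finset ι) (f : ι → ι → A)
    (hf : ∀ i j, i ≠ j → f i j + f j i = 0) :
    ∑ i ∈ s, ∑ j ∈ s.erase i, f i j = 0 := by
  rw [Finset.sum_sigma']
  refine Finset.sum_involution (fun p _ => ⟨p.2, p.1⟩) ?_ ?_ ?_ ?_
  · rintro ⟨i, j⟩ hp
    simp only [Finset.mem_sigma, Finset.mem_erase] at hp
    exact hf i j hp.2.1.symm
  · rintro ⟨i, j⟩ hp _ heq
    simp only [Finset.mem_sigma, Finset.mem_erase] at hp
    exact hp.2.1 (congrArg Sigma.fst heq)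
  · rintro ⟨i, j⟩ hp
    simp only [Finset.mem_sigma, Finset.mem_erase] at hp ⊢
    exact ⟨hp.2.2, hp.2.1.symm, hp.1⟩
  · intros
    rfl

/-- Fault-tolerance correctness: with `T = T_o ⊔ T_d`, each online client submits
`w'_k = w_k + r_k` and a recovery value `q_k = Σ_{n ∈ T_d} ε(k,n) h(k,n)`; then
`Σ_{k ∈ T_o} w'_k − Σ_{k ∈ T_o} q_k ≡ Σ_{k ∈ T_o} w_k (mod M)`. -/
theorem fault_tolerance_correct (M : ℕ) (hM : 1 ≤ M) (To Td : Finset ℕ)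
    (hdisj : Disjoint To Td)
    (h : ℕ → ℕ → ZMod M) (hsym : ∀ k n, k ≠ n → h k n = h n k)
    (w : ℕ → ZMod M)
    (r q : ℕ → ZMod M)
    (hr : ∀ k ∈ To, r k =
      ∑ n ∈ (To ∪ Td).erase k, (if n < k then (-1 : ZMod M) else 1) * h k n)
    (hq : ∀ k ∈ To, q k = ∑ n ∈ Td, (if n < k then (-1 : ZMod M) else 1) * h k n) :
    (∑ k ∈ To, (w k + r k)) - ∑ k ∈ To, q k = ∑ k ∈ To, w k := by
  have hrq : ∀ k ∈ To, w k + r k - q k =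
      w k + ∑ n ∈ To.erase k, (if n < k then (-1 : ZMod M) else 1) * h k n := by
    intro k hk
    have hkd : k ∉ Td := Finset.disjoint_left.mp hdisj hk
    rw [hr k hk, hq k hk, Finset.erase_union_distrib, Finset.erase_eq_of_notMem hkd,
      Finset.sum_union (hdisj.mono_left (Finset.erase_subset k To))]
    abel
  rw [← Finset.sum_sub_distrib, Finset.sum_congr rfl hrq, Finset.sum_add_distrib,
    Finset.sum_sum_erase_eq_zero_of_antisymm, add_zero]
  intro k n hkn
  rw [hsym k n hkn]
  rcases lt_or_gt_of_ne hkn with hlt | hlt <;> simp [hlt, hlt.not_gt]
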